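/- Let Ω ⊂ ℝⁿ be a bounded, smooth, convex domain and p > 1. There exist a constant C > 0 and a small ε > 0, independent of λ and u, such that for every λ > 0 and every stable classical solution u of the Navier problem Δ²u = λ(u+1)^p in Ω, u > 0 in Ω, u = Δu = 0 on ∂Ω, one has u(x) < C for all x ∈ Ω with dist(x, ∂Ω) < ε. -/

import Mathlib

open MeasureTheory Real RealInnerProductSpace

/-- The Laplacian of `f : ℝⁿ → ℝ`, as the trace of the second derivative. -/
noncomputable def lap {n : ℕ} (f : EuclideanSpace ℝ (Fin n) → ℝ)
    (x : EuclideanSpace ℝ (Fin n)) : ℝ :=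
  ∑ i : Fin n,
    iteratedFDeriv ℝ 2 f x ![EuclideanSpace.single i 1, EuclideanSpace.single i 1]

/-- Squared Frobenius norm of the Hessian of `f : ℝⁿ → ℝ`. -/
noncomputable def hessNormSq {n : ℕ} (f : EuclideanSpace ℝ (Fin n) → ℝ)
    (x : EuclideanSpace ℝ (Fin n)) : ℝ :=
  ∑ i : Fin n, ∑ j : Fin n,
    (iteratedFDeriv ℝ 2 f x ![EuclideanSpace.single i 1, EuclideanSpace.single j 1]) ^ 2

/-- The quantity `‖∇⁴(φ^{2γ})‖` defined by
`‖∇⁴(φ^{2γ})‖² = φ^{-2γ}|∇φ^γ|⁴ + |φ^γ Δ²φ^γ| + |∇²φ^γ|²`,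
with the first term interpreted as `0` where `φ = 0`. -/
noncomputable def norm4 {n : ℕ} (γ : ℝ) (φ : EuclideanSpace ℝ (Fin n) → ℝ)
    (x : EuclideanSpace ℝ (Fin n)) : ℝ :=
  Real.sqrt
    ((if φ x = 0 then 0 else φ x ^ (-(2*γ)) * ‖gradient (fun y => φ y ^ γ) x‖ ^ 4)
      + |φ x ^ γ * lap (lap (fun y => φ y ^ γ)) x|
      + hessNormSq (fun y => φ y ^ γ) x)

/-- `u` is a stable classical solution of the Navier problem
`Δ²u = lam (u+1)^p` in `Ω`, `u > 0` in `Ω`, `u = Δu = 0` on `∂Ω`; stability is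
tested on smooth functions vanishing on `∂Ω` (dense in `H²(Ω) ∩ H¹₀(Ω)`). -/
def IsStableSol {n : ℕ} (Ω : Set (EuclideanSpace ℝ (Fin n))) (p lam : ℝ)
    (u : EuclideanSpace ℝ (Fin n) → ℝ) : Prop :=
  ContDiff ℝ 4 u ∧ (∀ x ∈ Ω, 0 < u x) ∧
    (∀ x ∈ Ω, lap (lap u) x = lam * (u x + 1) ^ p) ∧
    (∀ x ∈ frontier Ω, u x = 0 ∧ lap u x = 0) ∧
    (∀ φ : EuclideanSpace ℝ (Fin n) → ℝ, ContDiff ℝ (⊤ : ℕ∞) φ →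
      (∀ x ∈ frontier Ω, φ x = 0) →
      lam * p * ∫ x in Ω, (u x + 1) ^ (p - 1) * φ x ^ 2 ≤ ∫ x in Ω, (lap φ x) ^ 2)

section

open InnerProductSpace Laplacian Set Filter Topology Metric

section Laplacian

variable {n : ℕ} {f g : EuclideanSpace ℝ (Fin n) → ℝ} {x : EuclideanSpace ℝ (Fin n)}

theorem lap_eq_laplacian (f : EuclideanSpace ℝ (Fin n) → ℝ) : lap f = Δ f := by
  rw [laplacian_eq_iteratedFDeriv_orthonormalBasis f (EuclideanSpace.basisFun (Fin n) ℝ)]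
  ext x
  simp [lap]

theorem lap_sub (hf : ContDiff ℝ 2 f) (hg : ContDiff ℝ 2 g) :
    lap (fun y => f y - g y) x = lap f x - lap g x := by
  simp only [lap_eq_laplacian]
  exact hf.contDiffAt.laplacian_sub hg.contDiffAt

theorem lap_const_mul (c : ℝ) (hf : ContDiff ℝ 2 f) :
    lap (fun y => c * f y) x = c * lap f x := by
  simp only [lap_eq_laplacian]
  exact laplacian_smul c hf.contDiffAt

theorem lap_comp_isometry_add (A : EuclideanSpace ℝ (Fin n) ≃ₗᵢ[ℝ] EuclideanSpace ℝ (Fin n))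
    (b : EuclideanSpace ℝ (Fin n)) (hf : ContDiff ℝ 2 f) :
    lap (fun y => f (A y + b)) x = lap f (A x + b) := by
  have h := (A.toContinuousLinearEquiv : EuclideanSpace ℝ (Fin n) →L[ℝ]
    EuclideanSpace ℝ (Fin n)).iteratedFDeriv_comp_right
    (f := fun y => f (y + b)) (hf.comp (contDiff_id.add contDiff_const)) x (i := 2) le_rfl
  have h' : lap (fun y => f (A y + b)) x =
      lap ((fun y => f (y + b)) ∘ (A.toContinuousLinearEquiv : EuclideanSpace ℝ (Fin n) →L[ℝ]
        EuclideanSpace ℝ (Fin n))) x := rfl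
  rw [h', lap_eq_laplacian f, laplacian_eq_iteratedFDeriv_orthonormalBasis f
    ((EuclideanSpace.basisFun (Fin n) ℝ).map A)]
  simp only [lap, h, iteratedFDeriv_comp_add_right]
  refine Finset.sum_congr rfl fun i _ => ?_
  rw [ContinuousMultilinearMap.compContinuousLinearMap_apply]
  congr 1
  ext j
  fin_cases j <;> simp

theorem hasDerivAt_comp_line (hf : Differentiable ℝ f) (x v : EuclideanSpace ℝ (Fin n)) (t : ℝ) :
    HasDerivAt (fun s : ℝ => f (x + s • v)) (fderiv ℝ f (x + t • v) v) t := by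
  have h : HasDerivAt (fun s : ℝ => x + s • v) v t := by
    simpa using ((hasDerivAt_id t).smul_const v).const_add x
  exact (hf (x + t • v)).hasFDerivAt.comp_hasDerivAt t h

theorem deriv_deriv_comp_line (hf : ContDiff ℝ 2 f) (x v : EuclideanSpace ℝ (Fin n)) :
    deriv (deriv fun t : ℝ => f (x + t • v)) 0 = iteratedFDeriv ℝ 2 f x ![v, v] := by
  have h1 : deriv (fun t : ℝ => f (x + t • v)) = fun t => fderiv ℝ f (x + t • v) v :=
    funext fun t => (hasDerivAt_comp_line (hf.differentiable (by norm_num)) x v t).deriv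
  have hd : Differentiable ℝ (fun y => fderiv ℝ f y v) :=
    ((hf.fderiv_right (m := 1) (by norm_num)).clm_apply contDiff_const).differentiable
      (by norm_num)
  rw [h1, (hasDerivAt_comp_line hd x v 0).deriv, iteratedFDeriv_two_apply]
  have hd' : DifferentiableAt ℝ (fderiv ℝ f) x :=
    (hf.fderiv_right (m := 1) (by norm_num)).differentiable (by norm_num) x
  simp [fderiv_clm_apply hd' (differentiableAt_const v)]

theorem lap_eq_sum_deriv_deriv (hf : ContDiff ℝ 2 f) :
    lap f x = ∑ i : Fin n,
      deriv (deriv fun t : ℝ => f (x + t • EuclideanSpace.single i (1 : ℝ))) 0 := by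
  simp only [lap, deriv_deriv_comp_line hf]

theorem deriv_deriv_nonneg_of_isLocalMin {φ : ℝ → ℝ} {a : ℝ} (h : IsLocalMin φ a)
    (hc : ContinuousAt φ a) : 0 ≤ deriv (deriv φ) a := by
  by_contra! hneg
  have hmax := isLocalMax_of_deriv_deriv_neg hneg h.deriv_eq_zero hc
  have heq : φ =ᶠ[𝓝 a] fun _ => φ a := by
    filter_upwards [h, hmax] with y h1 h2 using le_antisymm h2 h1
  have : deriv (deriv φ) a = 0 := by
    rw [heq.deriv.deriv_eq]; simp
  linarith

theorem lap_nonneg_of_isLocalMin (hf : ContDiff ℝ 2 f) (h : IsLocalMin f x) : 0 ≤ lap f x := by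
  rw [lap_eq_sum_deriv_deriv hf]
  refine Finset.sum_nonneg fun i _ => ?_
  have hc : Continuous fun t : ℝ => x + t • EuclideanSpace.single i (1 : ℝ) := by fun_prop
  refine deriv_deriv_nonneg_of_isLocalMin ?_ (hf.continuous.comp hc).continuousAt
  have ht : Tendsto (fun t : ℝ => x + t • EuclideanSpace.single i (1 : ℝ)) (𝓝 0) (𝓝 x) := by
    simpa using hc.tendsto 0
  simpa [IsLocalMin, IsMinFilter] using ht.eventually h

theorem contDiff_lap {k m : WithTop ℕ∞} (hf : ContDiff ℝ k f) (hm : m + 2 ≤ k) :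
    ContDiff ℝ m (lap f) := by
  unfold lap
  refine ContDiff.sum fun i _ => ?_
  have h1 : ContDiff ℝ m (iteratedFDeriv ℝ 2 f) := hf.iteratedFDeriv_right hm
  exact (ContinuousMultilinearMap.apply ℝ (fun _ : Fin 2 => EuclideanSpace ℝ (Fin n)) ℝ
    ![EuclideanSpace.single i 1, EuclideanSpace.single i 1]).contDiff.comp h1

/-- Minimum principle for strictly superharmonic functions. -/
theorem le_of_lap_neg {D : Set (EuclideanSpace ℝ (Fin n))} (hD : IsOpen D)
    (hb : Bornology.IsBounded D) (hf : ContDiff ℝ 2 f) (hlap : ∀ y ∈ D, lap f y < 0) {a : ℝ}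
    (hfr : ∀ y ∈ frontier D, a ≤ f y) : ∀ y ∈ D, a ≤ f y := by
  intro y hy
  obtain ⟨z, hz, hmin⟩ := hb.isCompact_closure.exists_isMinOn ⟨y, subset_closure hy⟩
    hf.continuous.continuousOn
  have hzD : z ∉ D := fun hzD => by
    have hloc : IsLocalMin f z := hmin.isLocalMin
      (mem_of_superset (hD.mem_nhds hzD) subset_closure)
    linarith [hlap z hzD, lap_nonneg_of_isLocalMin hf hloc]
  have hzf : z ∈ frontier D := by
    rw [hD.frontier_eq]; exact ⟨hz, hzD⟩
  exact (hfr z hzf).trans (hmin (subset_closure hy))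

theorem line_norm_sub_sq (x c : EuclideanSpace ℝ (Fin n)) (i : Fin n) (t : ℝ) :
    ‖x + t • EuclideanSpace.single i (1 : ℝ) - c‖ ^ 2 =
      ‖x - c‖ ^ 2 + 2 * (x i - c i) * t + t ^ 2 := by
  have h : x + t • EuclideanSpace.single i (1 : ℝ) - c =
      (x - c) + t • EuclideanSpace.single i (1 : ℝ) := by abel
  rw [h, norm_add_sq_real, inner_smul_right, EuclideanSpace.inner_single_right, norm_smul]
  simp
  ring

/-- The barrier function used for the Hopf lemma. -/
noncomputable def barrier (c : EuclideanSpace ℝ (Fin n)) (R K : ℝ)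
    (x : EuclideanSpace ℝ (Fin n)) : ℝ :=
  (R ^ 2 - ‖x - c‖ ^ 2) + K * (R ^ 2 - ‖x - c‖ ^ 2) ^ 2

theorem contDiff_barrier (c : EuclideanSpace ℝ (Fin n)) (R K : ℝ) {k : WithTop ℕ∞} :
    ContDiff ℝ k (barrier c R K) := by
  have h : ContDiff ℝ k fun x : EuclideanSpace ℝ (Fin n) => R ^ 2 - ‖x - c‖ ^ 2 :=
    contDiff_const.sub ((contDiff_id.sub contDiff_const).norm_sq ℝ)
  exact h.add (contDiff_const.mul (h.pow 2))

theorem lap_barrier (c : EuclideanSpace ℝ (Fin n)) (R K : ℝ) (x : EuclideanSpace ℝ (Fin n)) :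
    lap (barrier c R K) x =
      -2 * n + K * (8 * ‖x - c‖ ^ 2 - 4 * n * (R ^ 2 - ‖x - c‖ ^ 2)) := by
  rw [lap_eq_sum_deriv_deriv (contDiff_barrier c R K)]
  have key : ∀ a b : ℝ, deriv (deriv fun t : ℝ =>
      (R ^ 2 - (a + 2 * b * t + t ^ 2)) + K * (R ^ 2 - (a + 2 * b * t + t ^ 2)) ^ 2) 0 =
      -2 + K * (8 * b ^ 2 - 4 * (R ^ 2 - a)) := by
    intro a b
    have hq : ∀ t : ℝ, HasDerivAt (fun t : ℝ => R ^ 2 - (a + 2 * b * t + t ^ 2))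
        (-(2 * b + 2 * t)) t := fun t => by
      have := ((((hasDerivAt_id t).const_mul (2 * b)).const_add a).add
        (hasDerivAt_pow 2 t)).const_sub (R ^ 2)
      simpa using this
    have h1 : ∀ t : ℝ, HasDerivAt (fun t : ℝ =>
        (R ^ 2 - (a + 2 * b * t + t ^ 2)) + K * (R ^ 2 - (a + 2 * b * t + t ^ 2)) ^ 2)
        (-(2 * b + 2 * t) + K * (2 * (R ^ 2 - (a + 2 * b * t + t ^ 2)) * -(2 * b + 2 * t))) t :=
      fun t => ((hq t).add (((hq t).pow 2).const_mul K)).congr_deriv (by simp)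
    have hl : HasDerivAt (fun t : ℝ => -(2 * b + 2 * t)) (-2) 0 :=
      (((hasDerivAt_id (0 : ℝ)).const_mul 2).const_add (2 * b)).neg.congr_deriv (by simp)
    have h2 := hl.add (((((hq 0).const_mul 2).mul hl)).const_mul K)
    rw [show deriv (fun t : ℝ => (R ^ 2 - (a + 2 * b * t + t ^ 2)) +
      K * (R ^ 2 - (a + 2 * b * t + t ^ 2)) ^ 2) = _ from funext fun t => (h1 t).deriv]
    refine (h2.deriv).trans ?_
    ring
  simp only [barrier, line_norm_sub_sq, key, Finset.sum_add_distrib, ← Finset.mul_sum,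
    Finset.sum_sub_distrib]
  rw [EuclideanSpace.real_norm_sq_eq]
  simp
  ring

theorem lap_norm_sq (x : EuclideanSpace ℝ (Fin n)) :
    lap (fun y : EuclideanSpace ℝ (Fin n) => ‖y‖ ^ 2) x = 2 * n := by
  have h : (fun y : EuclideanSpace ℝ (Fin n) => ‖y‖ ^ 2) = fun y => (-1) * barrier 0 0 0 y := by
    ext y; simp [barrier]
  rw [h, lap_const_mul _ (contDiff_barrier _ _ _), lap_barrier]
  ring

/-- Weak minimum principle for superharmonic functions. -/
theorem nonneg_of_lap_nonpos (hn : 0 < n) {D : Set (EuclideanSpace ℝ (Fin n))} (hD : IsOpen D)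
    (hb : Bornology.IsBounded D) (hf : ContDiff ℝ 2 f) (hlap : ∀ y ∈ D, lap f y ≤ 0)
    (hfr : ∀ y ∈ frontier D, 0 ≤ f y) : ∀ y ∈ D, 0 ≤ f y := by
  intro y hy
  obtain ⟨M, hM⟩ := hb.closure.exists_norm_le
  have hsq : ContDiff ℝ 2 fun y : EuclideanSpace ℝ (Fin n) => ‖y‖ ^ 2 := contDiff_id.norm_sq ℝ
  have hε : ∀ ε > 0, -(ε * M ^ 2) ≤ f y := by
    intro ε hε
    have hn' : (0 : ℝ) < n := by exact_mod_cast hn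
    have := le_of_lap_neg hD hb (hf.sub (contDiff_const.mul hsq : ContDiff ℝ 2 fun y => ε * ‖y‖ ^ 2))
      (a := -(ε * M ^ 2)) (fun z hz => ?_) (fun z hz => ?_) y hy
    · have : 0 ≤ ε * ‖y‖ ^ 2 := by positivity
      linarith
    · rw [lap_sub hf (contDiff_const.mul hsq), lap_const_mul _ hsq, lap_norm_sq]
      have := hlap z hz
      have : 0 < ε * (2 * n) := by positivity
      linarith
    · have h1 : ‖z‖ ^ 2 ≤ M ^ 2 :=
        pow_le_pow_left₀ (norm_nonneg z) (hM z (frontier_subset_closure hz)) 2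
      have := mul_le_mul_of_nonneg_left h1 hε.le
      have := hfr z hz
      linarith
  have hlim : Tendsto (fun ε : ℝ => -(ε * M ^ 2)) (𝓝[>] 0) (𝓝 0) := by
    have : Continuous fun ε : ℝ => -(ε * M ^ 2) := by fun_prop
    simpa using (this.tendsto 0).mono_left nhdsWithin_le_nhds
  exact le_of_tendsto hlim (eventually_mem_nhdsWithin.mono hε)

end Laplacian

section Hopf

variable {n : ℕ} {f : EuclideanSpace ℝ (Fin n) → ℝ}

theorem HasDerivAt.nonpos_of_eventually_le {φ : ℝ → ℝ} {d a : ℝ} (h : HasDerivAt φ d a)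
    (hev : ∀ᶠ s in 𝓝[<] a, φ a ≤ φ s) : d ≤ 0 := by
  have h1 : Tendsto (slope φ a) (𝓝[<] a) (𝓝 d) :=
    (hasDerivAt_iff_tendsto_slope.1 h).mono_left (nhdsWithin_mono _ fun s hs => ne_of_lt hs)
  refine le_of_tendsto h1 ?_
  filter_upwards [hev, self_mem_nhdsWithin] with s hs hlt
  rw [slope_def_field]
  exact div_nonpos_of_nonneg_of_nonpos (sub_nonneg.2 hs) (sub_nonpos.2 (le_of_lt hlt))

theorem norm_add_smul_sub_sq (y c e : EuclideanSpace ℝ (Fin n)) (s : ℝ) :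
    ‖y + s • e - c‖ ^ 2 = ‖y - c‖ ^ 2 + 2 * s * inner ℝ (y - c) e + s ^ 2 * ‖e‖ ^ 2 := by
  rw [show y + s • e - c = (y - c) + s • e by abel, norm_add_sq_real, inner_smul_right, norm_smul,
    mul_pow, Real.norm_eq_abs, sq_abs]
  ring

theorem hasDerivAt_barrier_line (c y e : EuclideanSpace ℝ (Fin n)) {R K : ℝ}
    (hy : ‖y - c‖ = R) :
    HasDerivAt (fun s : ℝ => barrier c R K (y + s • e)) (-2 * inner ℝ (y - c) e) 0 := by
  simp only [barrier, norm_add_smul_sub_sq, hy]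
  have hq : HasDerivAt (fun s : ℝ =>
      R ^ 2 - (R ^ 2 + 2 * s * inner ℝ (y - c) e + s ^ 2 * ‖e‖ ^ 2)) (-2 * inner ℝ (y - c) e) 0 := by
    have := (((((hasDerivAt_id (0 : ℝ)).const_mul 2).mul_const (inner ℝ (y - c) e)).const_add
      (R ^ 2)).add ((hasDerivAt_pow 2 (0 : ℝ)).mul_const (‖e‖ ^ 2))).const_sub (R ^ 2)
    exact this.congr_deriv (by simp)
  exact (hq.add ((hq.pow 2).const_mul K)).congr_deriv (by simp)

/-- A positive superharmonic function on a ball lies above a multiple of the barrier near the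
boundary sphere. -/
theorem exists_barrier_le (hn : 0 < n) {c : EuclideanSpace ℝ (Fin n)} {R : ℝ} (hR : 0 < R)
    (hf : ContDiff ℝ 2 f) (hlap : ∀ z ∈ ball c R, lap f z ≤ 0) (hpos : ∀ z ∈ ball c R, 0 < f z) :
    ∃ K : ℝ, ∃ ε > 0, ∃ r < R ^ 2, ∀ z, r < ‖z - c‖ ^ 2 → ‖z - c‖ ^ 2 < R ^ 2 →
      ε * barrier c R K z ≤ f z := by
  have hn' : (0 : ℝ) < n := by exact_mod_cast hn
  have hnn : ∀ z, ‖z - c‖ ^ 2 ≤ R ^ 2 → 0 ≤ f z := by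
    intro z hz
    have hz' : z ∈ closure (ball c R) := by
      rw [closure_ball c hR.ne', mem_closedBall, dist_eq_norm]
      exact abs_le_of_sq_le_sq' hz hR.le |>.2
    have : closure (ball c R) ⊆ {z | 0 ≤ f z} :=
      closure_minimal (fun z hz => (hpos z hz).le) (isClosed_le continuous_const hf.continuous)
    exact this hz'
  set θ : ℝ := 1 / (n + 2) with hθ
  have hθ0 : 0 < θ := by positivity
  have hθ1 : θ * (n + 2) = 1 := by rw [hθ]; field_simp
  set r : ℝ := (1 - θ) * R ^ 2 with hr
  have hrR : r < R ^ 2 := by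
    have : 0 < θ * R ^ 2 := by positivity
    rw [hr]; linarith
  set K : ℝ := n / R ^ 2 with hK
  have hK0 : 0 < K := by positivity
  have hKR : K * R ^ 2 = n := by rw [hK]; field_simp
  have hcont : Continuous fun z : EuclideanSpace ℝ (Fin n) => ‖z - c‖ ^ 2 := by fun_prop
  have hS : IsCompact {z : EuclideanSpace ℝ (Fin n) | ‖z - c‖ ^ 2 = r} := by
    refine (isCompact_closedBall c R).of_isClosed_subset (isClosed_eq hcont continuous_const) ?_
    intro z hz
    rw [mem_closedBall, dist_eq_norm]
    exact abs_le_of_sq_le_sq' (hz.le.trans hrR.le) hR.le |>.2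
  obtain ⟨η, hη, hηf⟩ := hS.exists_forall_le' hf.continuous.continuousOn (a := 0) fun z hz => by
    refine hpos z ?_
    rw [mem_ball, dist_eq_norm]
    exact abs_lt_of_sq_lt_sq' (hz.trans_lt hrR) hR.le |>.2
  have hB : 0 < (R ^ 2 - r) + K * (R ^ 2 - r) ^ 2 := by
    have : 0 < R ^ 2 - r := sub_pos.2 hrR
    positivity
  set B := (R ^ 2 - r) + K * (R ^ 2 - r) ^ 2
  refine ⟨K, η / B, by positivity, r, hrR, fun z hz1 hz2 => ?_⟩
  have hε : 0 < η / B := by positivity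
  have hbar : ContDiff ℝ 2 (barrier c R K) := contDiff_barrier c R K
  have hD : IsOpen {z : EuclideanSpace ℝ (Fin n) | r < ‖z - c‖ ^ 2 ∧ ‖z - c‖ ^ 2 < R ^ 2} :=
    (isOpen_lt continuous_const hcont).inter (isOpen_lt hcont continuous_const)
  have hDb : Bornology.IsBounded
      {z : EuclideanSpace ℝ (Fin n) | r < ‖z - c‖ ^ 2 ∧ ‖z - c‖ ^ 2 < R ^ 2} := by
    refine isBounded_ball.subset (t := ball c R) fun z hz => ?_
    rw [mem_ball, dist_eq_norm]
    exact abs_lt_of_sq_lt_sq' hz.2 hR.le |>.2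
  have := le_of_lap_neg hD hDb (a := 0)
    (hf.sub (contDiff_const.mul hbar) : ContDiff ℝ 2 fun z => f z - η / B * barrier c R K z)
    (fun y hy => ?_) (fun y hy => ?_) z ⟨hz1, hz2⟩
  · linarith
  · rw [lap_sub hf (contDiff_const.mul hbar), lap_const_mul _ hbar, lap_barrier]
    have h1 : lap f y ≤ 0 := hlap y (by
      rw [mem_ball, dist_eq_norm]
      exact abs_lt_of_sq_lt_sq' hy.2 hR.le |>.2)
    have h2 : 4 * R ^ 2 ≤ 8 * ‖y - c‖ ^ 2 - 4 * n * (R ^ 2 - ‖y - c‖ ^ 2) := by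
      have h3 : (8 + 4 * n) * r ≤ (8 + 4 * n) * ‖y - c‖ ^ 2 :=
        mul_le_mul_of_nonneg_left hy.1.le (by positivity)
      have h4 : (8 + 4 * n) * r = (4 + 4 * n) * R ^ 2 := by
        rw [hr]; linear_combination (-4 * R ^ 2) * hθ1
      linarith
    have h5 := mul_le_mul_of_nonneg_left h2 hK0.le
    have h6 : 0 < η / B * (-2 * n + K * (8 * ‖y - c‖ ^ 2 - 4 * n * (R ^ 2 - ‖y - c‖ ^ 2))) := by
      refine mul_pos hε ?_
      nlinarith
    linarith
  · have hy' := frontier_subset_closure hy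
    have hcl : r ≤ ‖y - c‖ ^ 2 ∧ ‖y - c‖ ^ 2 ≤ R ^ 2 :=
      closure_minimal (t := {z | r ≤ ‖z - c‖ ^ 2 ∧ ‖z - c‖ ^ 2 ≤ R ^ 2})
        (fun z hz => ⟨hz.1.le, hz.2.le⟩)
        ((isClosed_le continuous_const hcont).inter (isClosed_le hcont continuous_const)) hy'
    have hnot : y ∉ {z | r < ‖z - c‖ ^ 2 ∧ ‖z - c‖ ^ 2 < R ^ 2} := by
      rw [hD.frontier_eq] at hy; exact hy.2
    rcases hcl.1.eq_or_lt with h | h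
    · have h1 : barrier c R K y = B := by simp only [barrier, ← h, B]
      have h2 := hηf y h.symm
      rw [h1, div_mul_cancel₀ _ hB.ne']
      linarith
    · have h' : ‖y - c‖ ^ 2 = R ^ 2 :=
        le_antisymm hcl.2 (not_lt.1 fun h'' => hnot ⟨h, h''⟩)
      have h1 : barrier c R K y = 0 := by simp [barrier, h']
      rw [h1]
      simpa using hnn y h'.le

/-- The Hopf boundary point lemma on a ball. -/
theorem fderiv_neg_of_lap_nonpos (hn : 0 < n) {c y e : EuclideanSpace ℝ (Fin n)} {R : ℝ}
    (hR : 0 < R) (hf : ContDiff ℝ 2 f) (hlap : ∀ z ∈ ball c R, lap f z ≤ 0)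
    (hpos : ∀ z ∈ ball c R, 0 < f z) (hy : dist y c = R) (hfy : f y = 0)
    (he : 0 < inner ℝ (y - c) e) : fderiv ℝ f y e < 0 := by
  obtain ⟨K, ε, hε, r, hr, h⟩ := exists_barrier_le hn hR hf hlap hpos
  rw [dist_eq_norm] at hy
  have h1 : HasDerivAt (fun s : ℝ => f (y + s • e)) (fderiv ℝ f y e) 0 := by
    simpa using hasDerivAt_comp_line (hf.differentiable (by norm_num)) y e 0
  have h2 := h1.sub ((hasDerivAt_barrier_line (K := K) c y e hy).const_mul ε)
  have h3 := h2.nonpos_of_eventually_le ?_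
  · have : 0 < ε * inner ℝ (y - c) e := by positivity
    linarith
  · have hc : Continuous fun s : ℝ => ‖y + s • e - c‖ ^ 2 := by fun_prop
    have e1 : ∀ᶠ s in 𝓝[<] (0 : ℝ), r < ‖y + s • e - c‖ ^ 2 := by
      refine nhdsWithin_le_nhds ((hc.tendsto 0).eventually_const_lt ?_)
      simpa [hy] using hr
    have hc' : Continuous fun s : ℝ => 2 * inner ℝ (y - c) e + s * ‖e‖ ^ 2 := by fun_prop
    have e2 : ∀ᶠ s in 𝓝[<] (0 : ℝ), 0 < 2 * inner ℝ (y - c) e + s * ‖e‖ ^ 2 := by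
      refine nhdsWithin_le_nhds ((hc'.tendsto 0).eventually_const_lt ?_)
      simpa using he
    filter_upwards [e1, e2, self_mem_nhdsWithin] with s hs1 hs2 hs
    have hs0 : s < 0 := hs
    have h4 : ‖y + s • e - c‖ ^ 2 < R ^ 2 := by
      rw [norm_add_smul_sub_sq, hy]
      nlinarith [mul_neg_of_neg_of_pos hs0 hs2]
    have h5 : barrier c R K y = 0 := by simp [barrier, hy]
    have := h _ hs1 h4
    simp only [Pi.sub_apply, zero_smul, add_zero, hfy, h5]
    linarith

theorem eventually_eq_zero_of_lap_nonpos (hn : 0 < n) {D : Set (EuclideanSpace ℝ (Fin n))}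
    (hD : IsOpen D) (hf : ContDiff ℝ 2 f) (hlap : ∀ z ∈ D, lap f z ≤ 0)
    (hnn : ∀ z ∈ D, 0 ≤ f z) {x : EuclideanSpace ℝ (Fin n)} (hx : x ∈ D) (hfx : f x = 0) :
    ∀ᶠ z in 𝓝 x, f z = 0 := by
  obtain ⟨r, hr, hrD⟩ := Metric.isOpen_iff.1 hD x hx
  filter_upwards [ball_mem_nhds x (half_pos hr)] with q hq
  rw [mem_ball] at hq
  by_contra hne
  have hZ : IsCompact (closedBall q (r / 2) ∩ {z | f z = 0}) :=
    (isCompact_closedBall q _).inter_right (isClosed_eq hf.continuous continuous_const)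
  obtain ⟨y, ⟨hyq, hfy⟩, hymin⟩ := hZ.exists_isMinOn
    (f := fun z => dist z q) ⟨x, by simpa [dist_comm] using hq.le, hfx⟩ (by fun_prop)
  change f y = 0 at hfy
  have hyq' : dist y q ≤ dist x q :=
    hymin (show x ∈ _ from ⟨by simpa [dist_comm] using hq.le, hfx⟩)
  have hyx : y ∈ D := hrD (by
    rw [mem_ball]
    have := dist_triangle y q x
    rw [dist_comm x q] at hyq'
    linarith)
  have hball : ball q (dist y q) ⊆ D := fun z hz => hrD (by
    rw [mem_ball] at hz ⊢
    have := dist_triangle z q x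
    rw [dist_comm x q] at hyq'
    linarith)
  have hyne : y ≠ q := fun h => hne (h ▸ hfy)
  have hlt := fderiv_neg_of_lap_nonpos hn (dist_pos.2 hyne) hf (fun z hz => hlap z (hball hz))
    (fun z hz => (hnn z (hball hz)).lt_of_ne fun h0 => ?_) rfl hfy (e := y - q) ?_
  · have hmin : IsLocalMin f y := by
      filter_upwards [hD.mem_nhds hyx] with z hz
      rw [hfy]; exact hnn z hz
    rw [hmin.fderiv_eq_zero] at hlt
    simp at hlt
  · rw [mem_ball] at hz
    have : dist y q ≤ dist z q :=
      hymin (show z ∈ _ from ⟨hz.le.trans hyq, h0.symm⟩)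
    linarith
  · exact real_inner_self_pos.2 (sub_ne_zero.2 hyne)

/-- Strong minimum principle for superharmonic functions. -/
theorem pos_or_eq_zero_of_lap_nonpos (hn : 0 < n) {D : Set (EuclideanSpace ℝ (Fin n))}
    (hD : IsOpen D) (hDc : IsPreconnected D) (hf : ContDiff ℝ 2 f)
    (hlap : ∀ z ∈ D, lap f z ≤ 0) (hnn : ∀ z ∈ D, 0 ≤ f z) :
    (∀ z ∈ D, 0 < f z) ∨ ∀ z ∈ D, f z = 0 := by
  by_contra! h
  obtain ⟨⟨x, hx, hfx⟩, y, hy, hfy⟩ := h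
  have hU : IsOpen {z | z ∈ D ∧ f z = 0} := by
    refine isOpen_iff_mem_nhds.2 fun z hz => ?_
    filter_upwards [hD.mem_nhds hz.1,
      eventually_eq_zero_of_lap_nonpos hn hD hf hlap hnn hz.1 hz.2] with q h1 h2 using ⟨h1, h2⟩
  have hV : IsOpen {z | 0 < f z} := isOpen_lt continuous_const hf.continuous
  obtain ⟨z, _, hz1, hz2⟩ := hDc _ _ hU hV
    (fun z hz => (hnn z hz).eq_or_lt.imp (fun h => ⟨hz, h.symm⟩) id)
    ⟨x, hx, hx, le_antisymm hfx (hnn x hx)⟩ ⟨y, hy, (hnn y hy).lt_of_ne' hfy⟩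
  exact absurd hz1.2 (ne_of_gt hz2)

end Hopf

section Reflection

variable {n : ℕ} {f : EuclideanSpace ℝ (Fin n) → ℝ} {e : EuclideanSpace ℝ (Fin n)} {t : ℝ}

/-- Reflection in the hyperplane `⟪x, e⟫ = t`, where `e` is a unit vector. -/
noncomputable def planeRefl (e : EuclideanSpace ℝ (Fin n)) (t : ℝ)
    (x : EuclideanSpace ℝ (Fin n)) : EuclideanSpace ℝ (Fin n) :=
  x + (2 * (t - inner ℝ x e)) • e

theorem planeRefl_eq (he : ‖e‖ = 1) (t : ℝ) (x : EuclideanSpace ℝ (Fin n)) :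
    planeRefl e t x = (ℝ ∙ e)ᗮ.reflection x + (2 * t) • e := by
  rw [Submodule.reflection_orthogonal_apply, Submodule.reflection_singleton_apply, planeRefl,
    real_inner_comm]
  simp only [he]
  module

theorem contDiff_planeRefl (he : ‖e‖ = 1) (t : ℝ) {k : WithTop ℕ∞} :
    ContDiff ℝ k (planeRefl e t) := by
  rw [funext (planeRefl_eq he t)]
  exact ((ℝ ∙ e)ᗮ.reflection.contDiff).add contDiff_const

theorem lap_comp_planeRefl (he : ‖e‖ = 1) (t : ℝ) (hf : ContDiff ℝ 2 f)
    (x : EuclideanSpace ℝ (Fin n)) :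
    lap (fun y => f (planeRefl e t y)) x = lap f (planeRefl e t x) := by
  simp only [planeRefl_eq he]
  exact lap_comp_isometry_add _ _ hf

theorem planeRefl_of_inner_eq {x : EuclideanSpace ℝ (Fin n)} (h : inner ℝ x e = t) :
    planeRefl e t x = x := by
  simp [planeRefl, h]

theorem continuous_planeRefl_uncurry (e : EuclideanSpace ℝ (Fin n)) :
    Continuous fun q : ℝ × EuclideanSpace ℝ (Fin n) => planeRefl e q.1 q.2 := by
  unfold planeRefl; fun_prop

theorem dist_planeRefl_lt (he : ‖e‖ = 1) {x c : EuclideanSpace ℝ (Fin n)}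
    (hx : t < inner ℝ x e) (hc : inner ℝ c e < t) : dist (planeRefl e t x) c < dist x c := by
  have h := norm_add_smul_sub_sq x c e (2 * (t - inner ℝ x e))
  rw [he, inner_sub_left] at h
  rw [dist_eq_norm, dist_eq_norm]
  refine abs_lt_of_sq_lt_sq' ?_ (norm_nonneg _) |>.2
  rw [planeRefl, h]
  nlinarith [mul_pos (sub_pos.2 hx) (sub_pos.2 hc)]

end Reflection

section MovingPlane

variable {n : ℕ} {Ω : Set (EuclideanSpace ℝ (Fin n))} {p lam m R T : ℝ}
  {u : EuclideanSpace ℝ (Fin n) → ℝ} {e : EuclideanSpace ℝ (Fin n)}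

/-- Every point of `closure Ω` lies in a closed ball of radius `R` whose interior is in `Ω`. -/
def UniformInteriorBall (Ω : Set (EuclideanSpace ℝ (Fin n))) (R : ℝ) : Prop :=
  ∀ x ∈ closure Ω, ∃ c, dist x c ≤ R ∧ ball c R ⊆ Ω

/-- `u` does not decrease under reflection of the cap `{x ∈ Ω | t < ⟪x, e⟫}`. -/
def CapMonotone (Ω : Set (EuclideanSpace ℝ (Fin n))) (u : EuclideanSpace ℝ (Fin n) → ℝ)
    (e : EuclideanSpace ℝ (Fin n)) (t : ℝ) : Prop :=
  ∀ x ∈ Ω, t < inner ℝ x e → u x ≤ u (planeRefl e t x)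

theorem inner_add_radius_le (he : ‖e‖ = 1) (hm : ∀ z ∈ Ω, inner ℝ z e ≤ m)
    {c : EuclideanSpace ℝ (Fin n)} (hR : 0 < R) (hc : ball c R ⊆ Ω) : inner ℝ c e + R ≤ m := by
  have h1 : ∀ z ∈ closure (ball c R), inner ℝ z e ≤ m :=
    closure_minimal (t := {z | inner ℝ z e ≤ m}) (fun z hz => hm z (hc hz))
      (isClosed_le (continuous_id.inner continuous_const) continuous_const)
  have h2 := h1 (c + R • e) (by
    rw [closure_ball c hR.ne', mem_closedBall, dist_eq_norm]
    simp [norm_smul, he, abs_of_pos hR])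
  rw [inner_add_left, real_inner_smul_left, real_inner_self_eq_norm_sq, he] at h2
  linarith

theorem planeRefl_mem (he : ‖e‖ = 1) (hm : ∀ z ∈ Ω, inner ℝ z e ≤ m) (hR : 0 < R)
    (hball : UniformInteriorBall Ω R) (hT : m - R < T) {x : EuclideanSpace ℝ (Fin n)}
    (hx : x ∈ closure Ω) (hxT : T < inner ℝ x e) : planeRefl e T x ∈ Ω := by
  obtain ⟨c, hxc, hc⟩ := hball x hx
  have := inner_add_radius_le he hm hR hc
  exact hc ((dist_planeRefl_lt he hxT (by linarith)).trans_le hxc)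

theorem IsStableSol.lap_nonpos (hn : 0 < n) (hopen : IsOpen Ω) (hbdd : Bornology.IsBounded Ω)
    (hlam : 0 < lam) (hu : IsStableSol Ω p lam u) : ∀ x ∈ Ω, lap u x ≤ 0 := by
  obtain ⟨hC, hpos, heq, hbc, -⟩ := hu
  have hV : ContDiff ℝ 2 (lap u) := contDiff_lap hC (by norm_num)
  intro x hx
  have := nonneg_of_lap_nonpos hn hopen hbdd
    (contDiff_const.mul hV : ContDiff ℝ 2 fun y => (-1) * lap u y)
    (fun y hy => ?_) (fun y hy => ?_) x hx
  · linarith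
  · rw [lap_const_mul _ hV, heq y hy]
    have : 0 < (u y + 1) ^ p := Real.rpow_pos_of_pos (by linarith [hpos y hy]) p
    have : 0 < lam * (u y + 1) ^ p := by positivity
    linarith
  · rw [(hbc y hy).2]; simp

theorem IsStableSol.fderiv_neg_of_mem_frontier (hn : 0 < n) (hopen : IsOpen Ω)
    (hbdd : Bornology.IsBounded Ω) (hlam : 0 < lam) (hu : IsStableSol Ω p lam u)
    (he : ‖e‖ = 1) (hm : ∀ z ∈ Ω, inner ℝ z e ≤ m) (hR : 0 < R)
    (hball : UniformInteriorBall Ω R) {y : EuclideanSpace ℝ (Fin n)} (hy : y ∈ frontier Ω)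
    (hyT : m - R < inner ℝ y e) : fderiv ℝ u y e < 0 := by
  obtain ⟨c, hyc, hc⟩ := hball y (frontier_subset_closure hy)
  have hyΩ : y ∉ Ω := by rw [hopen.frontier_eq] at hy; exact hy.2
  have hdist : dist y c = R := le_antisymm hyc (not_lt.1 fun h => hyΩ (hc h))
  have := inner_add_radius_le he hm hR hc
  refine fderiv_neg_of_lap_nonpos hn hR (hu.1.of_le (by norm_num))
    (fun z hz => hu.lap_nonpos hn hopen hbdd hlam z (hc hz)) (fun z hz => hu.2.1 z (hc hz)) hdist
    (hu.2.2.2.1 y hy).1 ?_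
  rw [inner_sub_left]; linarith

theorem isOpen_setOf_lt_inner (e : EuclideanSpace ℝ (Fin n)) (T : ℝ) :
    IsOpen {x : EuclideanSpace ℝ (Fin n) | T < inner ℝ x e} :=
  isOpen_lt continuous_const (continuous_id.inner continuous_const)

theorem isClosed_setOf_le_inner (e : EuclideanSpace ℝ (Fin n)) (T : ℝ) :
    IsClosed {x : EuclideanSpace ℝ (Fin n) | T ≤ inner ℝ x e} :=
  isClosed_le continuous_const (continuous_id.inner continuous_const)

theorem isOpen_cap (hopen : IsOpen Ω) (e : EuclideanSpace ℝ (Fin n)) (T : ℝ) :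
    IsOpen {x | x ∈ Ω ∧ T < inner ℝ x e} :=
  hopen.inter (isOpen_setOf_lt_inner e T)

theorem convex_cap (hconv : Convex ℝ Ω) (e : EuclideanSpace ℝ (Fin n)) (T : ℝ) :
    Convex ℝ {x | x ∈ Ω ∧ T < inner ℝ x e} := by
  have h : IsLinearMap ℝ fun x : EuclideanSpace ℝ (Fin n) => (inner ℝ x e : ℝ) :=
    ⟨fun x y => inner_add_left x y e, fun c x => real_inner_smul_left x e c⟩
  exact hconv.inter (convex_halfSpace_gt h T)

theorem closure_cap_subset (e : EuclideanSpace ℝ (Fin n)) (T : ℝ) :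
    closure {x | x ∈ Ω ∧ T < inner ℝ x e} ⊆ {x | x ∈ closure Ω ∧ T ≤ inner ℝ x e} :=
  closure_minimal (fun _ hx => ⟨subset_closure hx.1, hx.2.le⟩)
    (isClosed_closure.inter (isClosed_setOf_le_inner e T))

theorem IsStableSol.lap_planeRefl_le (hn : 0 < n) (hopen : IsOpen Ω)
    (hbdd : Bornology.IsBounded Ω) (hlam : 0 < lam) (hp : 0 ≤ p) (hu : IsStableSol Ω p lam u)
    (he : ‖e‖ = 1) (hm : ∀ z ∈ Ω, inner ℝ z e ≤ m) (hR : 0 < R)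
    (hball : UniformInteriorBall Ω R) (hT : m - R < T) (hmono : CapMonotone Ω u e T)
    {x : EuclideanSpace ℝ (Fin n)} (hx : x ∈ Ω) (hxT : T < inner ℝ x e) :
    lap u (planeRefl e T x) ≤ lap u x := by
  have hVneg := hu.lap_nonpos hn hopen hbdd hlam
  obtain ⟨hC, hpos, heq, hbc, -⟩ := hu
  have hV : ContDiff ℝ 2 (lap u) := contDiff_lap hC (by norm_num)
  have hVr : ContDiff ℝ 2 fun y => lap u (planeRefl e T y) := hV.comp (contDiff_planeRefl he T)
  refine sub_nonneg.1 (nonneg_of_lap_nonpos hn (isOpen_cap hopen e T)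
    (hbdd.subset fun y hy => hy.1) (hV.sub hVr) (fun y hy => ?_) (fun y hy => ?_) x ⟨hx, hxT⟩)
  · change lap (fun y => lap u y - lap u (planeRefl e T y)) y ≤ 0
    have hyr := planeRefl_mem he hm hR hball hT (subset_closure hy.1) hy.2
    rw [lap_sub hV hVr, lap_comp_planeRefl he T hV, heq y hy.1, heq _ hyr, sub_nonpos]
    have h1 := hmono y hy.1 hy.2
    have h2 := hpos y hy.1
    gcongr
  · have hcl := closure_cap_subset e T (frontier_subset_closure hy)
    rw [(isOpen_cap hopen e T).frontier_eq] at hy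
    rcases hcl.2.eq_or_lt with h | h
    · rw [planeRefl_of_inner_eq h.symm, sub_self]
    · have hyf : y ∈ frontier Ω := by
        rw [hopen.frontier_eq]; exact ⟨hcl.1, fun hyΩ => hy.2 ⟨hyΩ, h⟩⟩
      have := hVneg _ (planeRefl_mem he hm hR hball hT hcl.1 h)
      rw [(hbc y hyf).2]
      linarith

theorem IsStableSol.lt_planeRefl (hn : 0 < n) (hopen : IsOpen Ω)
    (hbdd : Bornology.IsBounded Ω) (hconv : Convex ℝ Ω) (hlam : 0 < lam) (hp : 0 ≤ p)
    (hu : IsStableSol Ω p lam u)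
    (he : ‖e‖ = 1) (hm : ∀ z ∈ Ω, inner ℝ z e ≤ m) (hR : 0 < R)
    (hball : UniformInteriorBall Ω R) (hT : m - R < T) (hmono : CapMonotone Ω u e T)
    {x : EuclideanSpace ℝ (Fin n)} (hx : x ∈ Ω) (hxT : T < inner ℝ x e) :
    u x < u (planeRefl e T x) := by
  have hu2 : ContDiff ℝ 2 u := hu.1.of_le (by norm_num)
  have hur : ContDiff ℝ 2 fun y => u (planeRefl e T y) := hu2.comp (contDiff_planeRefl he T)
  rcases pos_or_eq_zero_of_lap_nonpos hn (isOpen_cap hopen e T)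
    (convex_cap hconv e T).isPreconnected (hur.sub hu2) (fun y hy => by
      change lap (fun y => u (planeRefl e T y) - u y) y ≤ 0
      rw [lap_sub hur hu2, lap_comp_planeRefl he T hu2, sub_nonpos]
      exact hu.lap_planeRefl_le hn hopen hbdd hlam hp he hm hR hball hT hmono hy.1 hy.2)
    (fun y hy => sub_nonneg.2 (hmono y hy.1 hy.2)) with h | h
  · exact sub_pos.1 (h x ⟨hx, hxT⟩)
  · exfalso
    obtain ⟨y, hy, hymax⟩ := hbdd.isCompact_closure.exists_isMaxOn ⟨x, subset_closure hx⟩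
      (f := fun z => (inner ℝ z e : ℝ)) (by fun_prop)
    have hyT : T < inner ℝ y e := hxT.trans_le (hymax (subset_closure hx))
    have hyΩ : y ∉ Ω := fun hyΩ => by
      have hc : Continuous fun s : ℝ => y + s • e := by fun_prop
      have hev : ∀ᶠ s in 𝓝[>] (0 : ℝ), y + s • e ∈ Ω :=
        nhdsWithin_le_nhds (hc.continuousAt.eventually_mem (hopen.mem_nhds (by simpa using hyΩ)))
      obtain ⟨s, hs, hs0⟩ := (hev.and self_mem_nhdsWithin).exists
      have h1 : inner ℝ (y + s • e) e ≤ inner ℝ y e := hymax (subset_closure hs)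
      rw [inner_add_left, real_inner_smul_left, real_inner_self_eq_norm_sq, he] at h1
      have : 0 < s := hs0
      linarith
    have hyf : y ∈ frontier Ω := by rw [hopen.frontier_eq]; exact ⟨hy, hyΩ⟩
    have hcl : y ∈ closure {x | x ∈ Ω ∧ T < inner ℝ x e} :=
      (isOpen_setOf_lt_inner e T).closure_inter ⟨hy, hyT⟩
    have hzero : closure {x | x ∈ Ω ∧ T < inner ℝ x e} ⊆ {z | u (planeRefl e T z) - u z = 0} :=
      closure_minimal h (isClosed_eq (hur.sub hu2).continuous continuous_const)
    have h1 : u (planeRefl e T y) - u y = 0 := hzero hcl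
    have h2 := hu.2.1 _ (planeRefl_mem he hm hR hball hT hy hyT)
    rw [(hu.2.2.2.1 y hyf).1] at h1
    linarith

theorem IsStableSol.fderiv_neg_of_capMonotone (hn : 0 < n) (hopen : IsOpen Ω)
    (hbdd : Bornology.IsBounded Ω) (hconv : Convex ℝ Ω) (hlam : 0 < lam) (hp : 0 ≤ p)
    (hu : IsStableSol Ω p lam u)
    (he : ‖e‖ = 1) (hm : ∀ z ∈ Ω, inner ℝ z e ≤ m) (hR : 0 < R)
    (hball : UniformInteriorBall Ω R) (hT : m - R < T) (hmono : CapMonotone Ω u e T)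
    {x : EuclideanSpace ℝ (Fin n)} (hx : x ∈ Ω) (hxT : inner ℝ x e = T) :
    fderiv ℝ u x e < 0 := by
  have hu2 : ContDiff ℝ 2 u := hu.1.of_le (by norm_num)
  have hur : ContDiff ℝ 2 fun y => u (planeRefl e T y) := hu2.comp (contDiff_planeRefl he T)
  have hw : ContDiff ℝ 2 fun y => u (planeRefl e T y) - u y := hur.sub hu2
  obtain ⟨r, hr, hrΩ⟩ := Metric.isOpen_iff.1 hopen x hx
  have hcx : dist x (x + (r / 2) • e) = r / 2 := by
    rw [dist_eq_norm]; simp [norm_smul, he, abs_of_pos hr]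
  have hsub : ∀ z ∈ ball (x + (r / 2) • e) (r / 2), z ∈ Ω ∧ T < inner ℝ z e := by
    intro z hz
    rw [mem_ball] at hz
    refine ⟨hrΩ ?_, ?_⟩
    · have := dist_triangle_right z x (x + (r / 2) • e)
      rw [mem_ball]
      linarith
    · have h1 : inner ℝ (x + (r / 2) • e - z) e ≤ dist z (x + (r / 2) • e) := by
        have := real_inner_le_norm (x + (r / 2) • e - z) e
        rwa [he, mul_one, ← dist_eq_norm, dist_comm] at this
      rw [inner_sub_left, inner_add_left, real_inner_smul_left, real_inner_self_eq_norm_sq, he,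
        hxT] at h1
      linarith
  have hneg := fderiv_neg_of_lap_nonpos hn (half_pos hr) hw (fun z hz => ?_) (fun z hz => ?_) hcx
    (by rw [planeRefl_of_inner_eq hxT, sub_self]) (e := -e) ?_
  · have hl := hasDerivAt_comp_line (hw.differentiable (by norm_num)) x (-e) 0
    have hud : Differentiable ℝ u := hu2.differentiable (by norm_num)
    have heq : (fun s : ℝ => u (planeRefl e T (x + s • -e)) - u (x + s • -e)) =
        fun s : ℝ => u (x + s • e) - u (x + s • -e) := by
      ext s
      congr 2
      rw [planeRefl, inner_add_left, real_inner_smul_left, inner_neg_left,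
        real_inner_self_eq_norm_sq, he, hxT]
      module
    rw [heq] at hl
    have := hl.unique ((hasDerivAt_comp_line hud x e 0).sub (hasDerivAt_comp_line hud x (-e) 0))
    simp only [zero_smul, add_zero, map_neg] at this hneg
    linarith
  · obtain ⟨hz1, hz2⟩ := hsub z hz
    rw [lap_sub hur hu2, lap_comp_planeRefl he T hu2, sub_nonpos]
    exact hu.lap_planeRefl_le hn hopen hbdd hlam hp he hm hR hball hT hmono hz1 hz2
  · obtain ⟨hz1, hz2⟩ := hsub z hz
    exact sub_pos.2 (hu.lt_planeRefl hn hopen hbdd hconv hlam hp he hm hR hball hT hmono hz1 hz2)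
  · rw [sub_add_cancel_left, inner_neg_neg, real_inner_smul_left, real_inner_self_eq_norm_sq, he]
    linarith

theorem lt_of_fderiv_neg_on_ball {f : EuclideanSpace ℝ (Fin n) → ℝ} (hf : Differentiable ℝ f)
    {x y : EuclideanSpace ℝ (Fin n)} {r s : ℝ} (hneg : ∀ z ∈ ball x r, fderiv ℝ f z e < 0)
    (hs : 0 < s) (hy : y ∈ ball x r) (hys : y + s • e ∈ ball x r) : f (y + s • e) < f y := by
  have hanti : StrictAntiOn (fun t : ℝ => f (y + t • e)) (Icc 0 s) := by
    refine strictAntiOn_of_deriv_neg (convex_Icc 0 s)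
      (hf.continuous.comp (by fun_prop)).continuousOn fun t ht => ?_
    rw [interior_Icc] at ht
    rw [(hasDerivAt_comp_line hf y e t).deriv]
    refine hneg _ ?_
    have := (convex_ball x r).add_smul_sub_mem hy hys (t := t / s)
      ⟨div_nonneg ht.1.le hs.le, (div_le_one hs).2 ht.2.le⟩
    rwa [add_sub_cancel_left, smul_smul, div_mul_cancel₀ _ hs.ne'] at this
  simpa using hanti (left_mem_Icc.2 hs.le) (right_mem_Icc.2 hs.le) hs

theorem IsStableSol.eventually_capMonotone (hn : 0 < n) (hopen : IsOpen Ω)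
    (hbdd : Bornology.IsBounded Ω) (hconv : Convex ℝ Ω) (hlam : 0 < lam) (hp : 0 ≤ p)
    (hu : IsStableSol Ω p lam u)
    (he : ‖e‖ = 1) (hm : ∀ z ∈ Ω, inner ℝ z e ≤ m) (hR : 0 < R)
    (hball : UniformInteriorBall Ω R) (hT : m - R < T) (hmono : CapMonotone Ω u e T) :
    ∀ᶠ t in 𝓝[<] T, CapMonotone Ω u e t := by
  by_contra hcon
  have hu2 : ContDiff ℝ 2 u := hu.1.of_le (by norm_num)
  have hcu : Continuous u := hu2.continuous
  obtain ⟨t, htT, ht⟩ := exists_seq_forall_of_frequently (not_eventually.1 hcon)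
  unfold CapMonotone at ht
  push Not at ht
  choose y hyΩ hyt hyu using ht
  obtain ⟨x, hx, φ, hφ, hlim⟩ :=
    hbdd.isCompact_closure.tendsto_subseq fun k => subset_closure (hyΩ k)
  have htφ : Tendsto (t ∘ φ) atTop (𝓝 T) :=
    (htT.mono_right nhdsWithin_le_nhds).comp hφ.tendsto_atTop
  have hrefl : Tendsto (fun k => planeRefl e (t (φ k)) (y (φ k))) atTop (𝓝 (planeRefl e T x)) :=
    ((continuous_planeRefl_uncurry e).tendsto (T, x)).comp (htφ.prodMk_nhds hlim)
  have hin : Continuous fun z : EuclideanSpace ℝ (Fin n) => (inner ℝ z e : ℝ) := by fun_prop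
  have hxT : T ≤ inner ℝ x e :=
    le_of_tendsto_of_tendsto' htφ ((hin.tendsto x).comp hlim) fun k => (hyt (φ k)).le
  have hxu : u (planeRefl e T x) ≤ u x :=
    le_of_tendsto_of_tendsto' ((hcu.tendsto _).comp hrefl) ((hcu.tendsto x).comp hlim)
      fun k => (hyu (φ k)).le
  rcases hxT.eq_or_lt with heq | hlt
  · have hneg : fderiv ℝ u x e < 0 := by
      by_cases hxΩ : x ∈ Ω
      · exact hu.fderiv_neg_of_capMonotone hn hopen hbdd hconv hlam hp he hm hR hball hT hmono
          hxΩ heq.symm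
      · exact hu.fderiv_neg_of_mem_frontier hn hopen hbdd hlam he hm hR hball
          (by rw [hopen.frontier_eq]; exact ⟨hx, hxΩ⟩) (heq ▸ hT)
    have hcont : Continuous fun z => fderiv ℝ u z e :=
      (hu2.continuous_fderiv (by norm_num)).clm_apply continuous_const
    obtain ⟨r, hr, hrneg⟩ := Metric.eventually_nhds_iff_ball.1
      ((hcont.tendsto x).eventually_lt_const hneg)
    rw [planeRefl_of_inner_eq heq.symm] at hrefl
    obtain ⟨k, hk1, hk2⟩ := ((hlim.eventually_mem (ball_mem_nhds x hr)).and
      (hrefl.eventually_mem (ball_mem_nhds x hr))).exists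
    have hback : planeRefl e (t (φ k)) (y (φ k)) +
        (2 * (inner ℝ (y (φ k)) e - t (φ k))) • e = y (φ k) := by
      rw [planeRefl]; module
    have := lt_of_fderiv_neg_on_ball (hu2.differentiable (by norm_num)) hrneg
      (s := 2 * (inner ℝ (y (φ k)) e - t (φ k))) (by linarith [hyt (φ k)]) hk2
      (by rw [hback]; exact hk1)
    rw [hback] at this
    exact lt_asymm this (hyu (φ k))
  · by_cases hxΩ : x ∈ Ω
    · exact hxu.not_gt
        (hu.lt_planeRefl hn hopen hbdd hconv hlam hp he hm hR hball hT hmono hxΩ hlt)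
    · have h1 := (hu.2.2.2.1 x (by rw [hopen.frontier_eq]; exact ⟨hx, hxΩ⟩)).1
      have h2 := hu.2.1 _ (planeRefl_mem he hm hR hball hT hx hlt)
      linarith

theorem isClosed_setOf_capMonotone (hu : Continuous u) :
    IsClosed {t | CapMonotone Ω u e t} := by
  have h : {t | CapMonotone Ω u e t} =
      ⋂ x ∈ Ω, ({t | inner ℝ x e ≤ t} ∪ {t | u x ≤ u (planeRefl e t x)}) := by
    ext t
    simp only [CapMonotone, mem_ofPred_eq, mem_iInter, mem_union, ← not_lt (a := t),
      ← imp_iff_not_or]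
  rw [h]
  refine isClosed_biInter fun x _ => (isClosed_le continuous_const continuous_id).union ?_
  exact isClosed_le continuous_const (hu.comp ((continuous_planeRefl_uncurry e).comp
    (continuous_id.prodMk continuous_const)))

theorem IsStableSol.capMonotone (hn : 0 < n) (hopen : IsOpen Ω)
    (hbdd : Bornology.IsBounded Ω) (hconv : Convex ℝ Ω) (hlam : 0 < lam) (hp : 0 ≤ p)
    (hu : IsStableSol Ω p lam u)
    (he : ‖e‖ = 1) (hm : ∀ z ∈ Ω, inner ℝ z e ≤ m) (hR : 0 < R)
    (hball : UniformInteriorBall Ω R) {δ : ℝ} (hδ : δ < R) {t : ℝ} (ht : t ∈ Icc (m - δ) m) :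
    CapMonotone Ω u e t := by
  have hsub : Icc 0 δ ⊆ {τ | CapMonotone Ω u e (m - τ)} := by
    refine IsClosed.Icc_subset_of_forall_mem_nhdsWithin ?_ ?_ ?_
    · exact ((isClosed_setOf_capMonotone hu.1.continuous).preimage
        (continuous_const.sub continuous_id)).inter isClosed_Icc
    · intro x hx hlt
      rw [sub_zero] at hlt
      exact absurd (hm x hx) hlt.not_ge
    · rintro τ ⟨hτ, hτ0, hτδ⟩
      have hev := hu.eventually_capMonotone hn hopen hbdd hconv hlam hp he hm hR hball
        (by linarith) hτ
      have hlim : Tendsto (fun s => m - s) (𝓝[>] τ) (𝓝[<] (m - τ)) := by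
        refine tendsto_nhdsWithin_iff.2 ⟨?_, ?_⟩
        · exact ((continuous_const.sub continuous_id).tendsto τ).mono_left nhdsWithin_le_nhds
        · filter_upwards [self_mem_nhdsWithin] with s hs
          exact sub_lt_sub_left hs m
      exact hlim.eventually hev
  have := hsub (show m - t ∈ Icc 0 δ from ⟨by linarith [ht.2], by linarith [ht.1]⟩)
  simpa using this

end MovingPlane

section Geometry

variable {n : ℕ} {Ω : Set (EuclideanSpace ℝ (Fin n))} {R : ℝ}

theorem exists_supporting_normal (hopen : IsOpen Ω) (hconv : Convex ℝ Ω) (hne : Ω.Nonempty)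
    {y : EuclideanSpace ℝ (Fin n)} (hy : y ∉ Ω) :
    ∃ ν : EuclideanSpace ℝ (Fin n), ‖ν‖ = 1 ∧ ∀ z ∈ Ω, inner ℝ z ν ≤ inner ℝ y ν := by
  obtain ⟨g, hg⟩ := geometric_hahn_banach_open_point hconv hopen hy
  set w := (toDual ℝ (EuclideanSpace ℝ (Fin n))).symm g
  have hw : ∀ z, inner ℝ z w = g z := fun z => by
    rw [real_inner_comm]; exact toDual_symm_apply
  have hw0 : w ≠ 0 := fun h0 => by
    obtain ⟨z, hz⟩ := hne
    have := hg z hz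
    rw [← hw, ← hw, h0] at this
    simp at this
  refine ⟨‖w‖⁻¹ • w, norm_smul_inv_norm hw0, fun z hz => ?_⟩
  rw [inner_smul_right, inner_smul_right, hw, hw]
  exact mul_le_mul_of_nonneg_left (hg z hz).le (inv_nonneg.2 (norm_nonneg w))

theorem eq_sub_smul_of_ball_subset {y ν c : EuclideanSpace ℝ (Fin n)} {r : ℝ} (hν : ‖ν‖ = 1)
    (hsupp : ∀ z ∈ Ω, inner ℝ z ν ≤ inner ℝ y ν) (hr : 0 < r) (hy : dist y c = r)
    (hc : ball c r ⊆ Ω) : c = y - r • ν := by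
  have h := inner_add_radius_le hν hsupp hr hc
  have h1 := norm_add_smul_sub_sq y c ν (-r)
  rw [← dist_eq_norm y c, hy, hν, inner_sub_left] at h1
  have h2 : ‖y + -r • ν - c‖ ^ 2 ≤ 0 := by
    rw [h1]; nlinarith
  have h3 : y + -r • ν - c = 0 := by
    rw [← norm_eq_zero]; exact pow_eq_zero_iff two_ne_zero |>.1 (le_antisymm h2 (sq_nonneg _))
  rw [← sub_eq_zero.1 h3]; module

theorem exists_interior_ball_of_defining_function (hbdd : Bornology.IsBounded Ω)
    {f : EuclideanSpace ℝ (Fin n) → ℝ} (hf : ContDiff ℝ 2 f) (hΩ : Ω = f ⁻¹' Iio 0)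
    (hfr : ∀ x ∈ frontier Ω, f x = 0) (hgrad : ∀ x ∈ frontier Ω, gradient f x ≠ 0) :
    ∃ R > 0, ∀ y ∈ frontier Ω, ∃ c, dist y c = R ∧ ball c R ⊆ Ω := by
  have hK : IsCompact (frontier Ω) :=
    hbdd.isCompact_closure.of_isClosed_subset isClosed_frontier frontier_subset_closure
  have hf1 : ContDiff ℝ 1 (fderiv ℝ f) := hf.fderiv_right (by norm_num)
  have hgc : Continuous (gradient f) :=
    (toDual ℝ (EuclideanSpace ℝ (Fin n))).symm.continuous.comp hf1.continuous
  obtain ⟨a, ha, hag⟩ := hK.exists_forall_le' (f := fun y => ‖gradient f y‖) (a := 0)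
    hgc.norm.continuousOn fun y hy => norm_pos_iff.2 (hgrad y hy)
  obtain ⟨M, hM⟩ := hK.isBounded.exists_norm_le
  obtain ⟨L, hL⟩ := hf1.contDiffOn.exists_lipschitzOnWith one_ne_zero
    (convex_closedBall (0 : EuclideanSpace ℝ (Fin n)) (M + 1)) (isCompact_closedBall _ _)
  have hL0 : (0 : ℝ) ≤ L := L.2
  refine ⟨min (1 / 2) (a / (2 * (L + 1))), by positivity, fun y hy => ?_⟩
  set R := min (1 / 2) (a / (2 * (L + 1))) with hRdef
  have hR : 0 < R := by positivity
  have hR1 : 2 * R ≤ 1 := by linarith [min_le_left (1 / 2) (a / (2 * ((L : ℝ) + 1)))]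
  have hR2 : 2 * R * L ≤ a := by
    have h1 : R ≤ a / (2 * (L + 1)) := min_le_right _ _
    rw [le_div_iff₀ (by positivity)] at h1
    nlinarith
  set G := gradient f y
  have hG : 0 < ‖G‖ := norm_pos_iff.2 (hgrad y hy)
  have hGa : a ≤ ‖G‖ := hag y hy
  have hnorm : ‖(R / ‖G‖) • G‖ = R := by
    rw [norm_smul, norm_div, norm_norm, Real.norm_eq_abs, abs_of_pos hR,
      div_mul_cancel₀ _ hG.ne']
  refine ⟨y - (R / ‖G‖) • G, by rw [dist_eq_norm, sub_sub_cancel, hnorm], fun z hz => ?_⟩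
  have hzy : ‖z - y‖ ≤ 1 := by
    have h1 := dist_triangle z (y - (R / ‖G‖) • G) y
    have h2 : dist (y - (R / ‖G‖) • G) y = R := by
      rw [dist_comm, dist_eq_norm, sub_sub_cancel, hnorm]
    rw [mem_ball] at hz
    rw [← dist_eq_norm]
    linarith
  have hsq : 2 * (R / ‖G‖) * inner ℝ G (z - y) < -‖z - y‖ ^ 2 := by
    rw [mem_ball, dist_eq_norm, show z - (y - (R / ‖G‖) • G) = (z - y) + (R / ‖G‖) • G by abel]
      at hz
    have h1 := pow_lt_pow_left₀ hz (norm_nonneg _) two_ne_zero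
    rw [norm_add_sq_real, hnorm, inner_smul_right, real_inner_comm] at h1
    linarith
  have hyM := hM y hy
  have hsub : closedBall y ‖z - y‖ ⊆ closedBall (0 : EuclideanSpace ℝ (Fin n)) (M + 1) :=
    closedBall_subset_closedBall' (by rw [dist_zero_right]; linarith)
  have htaylor := (convex_closedBall y ‖z - y‖).norm_image_sub_le_of_norm_fderiv_le'
    (f := f) (𝕜 := ℝ) (C := L * ‖z - y‖) (φ := fderiv ℝ f y)
    (fun w _ => hf.differentiable (by norm_num) w)
    (fun w hw => by
      have h1 := hL.dist_le_mul w (hsub hw) y (hsub (mem_closedBall_self (norm_nonneg _)))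
      rw [dist_eq_norm] at h1
      exact h1.trans (mul_le_mul_of_nonneg_left hw hL0))
    (mem_closedBall_self (norm_nonneg _)) (y := z) (by rw [mem_closedBall, dist_eq_norm])
  rw [hfr y hy, sub_zero, ← inner_gradient_left, Real.norm_eq_abs] at htaylor
  have h2 := (abs_le.1 htaylor).2
  rw [hΩ, mem_preimage, mem_Iio]
  change f z - inner ℝ G (z - y) ≤ _ at h2
  have h3 : 2 * R * inner ℝ G (z - y) < -(‖G‖ * ‖z - y‖ ^ 2) := by
    have := mul_lt_mul_of_pos_left hsq hG
    have h4 : ‖G‖ * (2 * (R / ‖G‖) * inner ℝ G (z - y)) = 2 * R * inner ℝ G (z - y) := by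
      field_simp
    linarith
  have h5 : 2 * R * L * ‖z - y‖ ^ 2 ≤ ‖G‖ * ‖z - y‖ ^ 2 :=
    mul_le_mul_of_nonneg_right (hR2.trans hGa) (sq_nonneg _)
  have h6 : 2 * R * f z ≤ 2 * R * (inner ℝ G (z - y) + L * ‖z - y‖ * ‖z - y‖) :=
    mul_le_mul_of_nonneg_left (by linarith) (by positivity)
  have h7 : 2 * R * f z < 0 := by nlinarith
  exact neg_of_mul_neg_right h7 (by positivity)

theorem uniformInteriorBall_of_frontier (hopen : IsOpen Ω) (hconv : Convex ℝ Ω) (hR : 0 < R)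
    (h : ∀ y ∈ frontier Ω, ∃ c, dist y c = R ∧ ball c R ⊆ Ω) : UniformInteriorBall Ω R := by
  intro x hx
  by_cases hxΩ : x ∈ Ω
  swap
  · obtain ⟨c, hc, hcb⟩ := h x (by rw [hopen.frontier_eq]; exact ⟨hx, hxΩ⟩)
    exact ⟨c, hc.le, hcb⟩
  rcases Ωᶜ.eq_empty_or_nonempty with hemp | hne
  · exact ⟨x, by simpa using hR.le, by simp [compl_empty_iff.1 hemp]⟩
  obtain ⟨y, hy, hd⟩ := hopen.isClosed_compl.exists_infDist_eq_dist hne x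
  have hball : ball x (dist x y) ⊆ Ω := hd ▸ ball_infDist_compl_subset
  rcases le_or_gt R (dist x y) with hle | hlt
  · exact ⟨x, by simpa using hR.le, (ball_subset_ball hle).trans hball⟩
  have hxy : 0 < dist x y := dist_pos.2 fun hxy => hy (hxy ▸ hxΩ)
  have hyf : y ∈ frontier Ω := by
    rw [hopen.frontier_eq]
    refine ⟨closure_mono hball ?_, hy⟩
    rw [closure_ball x hxy.ne', mem_closedBall, dist_comm]
  obtain ⟨ν, hν, hsupp⟩ := exists_supporting_normal hopen hconv ⟨x, hxΩ⟩ hy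
  obtain ⟨c, hc, hcb⟩ := h y hyf
  have h1 := eq_sub_smul_of_ball_subset hν hsupp hR hc hcb
  have h2 := eq_sub_smul_of_ball_subset hν hsupp hxy (dist_comm y x) hball
  refine ⟨c, ?_, hcb⟩
  rw [dist_eq_norm, h1]
  nth_rw 1 [h2]
  rw [show y - dist x y • ν - (y - R • ν) = (R - dist x y) • ν by module, norm_smul, hν,
    Real.norm_eq_abs, abs_of_pos (sub_pos.2 hlt)]
  linarith

end Geometry

section BoundaryBound

variable {n : ℕ} {Ω : Set (EuclideanSpace ℝ (Fin n))} {p lam R : ℝ}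
  {u : EuclideanSpace ℝ (Fin n) → ℝ}

theorem norm_inv_smul_sub_le {w ν : EuclideanSpace ℝ (Fin n)} {δ κ : ℝ} (hδ : 0 < δ)
    (hκ1 : κ ≤ 1) (hν : ‖ν‖ = 1) (hw : ‖w - (δ / 2) • ν‖ ≤ κ * δ / 8) :
    0 < ‖w‖ ∧ ‖w‖ ≤ δ ∧ ‖‖w‖⁻¹ • w - ν‖ ≤ κ := by
  have h1 : ‖(δ / 2) • ν‖ = δ / 2 := by rw [norm_smul, hν, Real.norm_eq_abs, abs_of_pos] <;> linarith
  have h2 : |‖w‖ - δ / 2| ≤ κ * δ / 8 := by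
    have h := abs_norm_sub_norm_le w ((δ / 2) • ν)
    rw [h1] at h
    exact h.trans hw
  have hκδ : κ * δ ≤ δ := by nlinarith
  have h3 := abs_le.1 h2
  have hpos : 0 < ‖w‖ := by linarith
  refine ⟨hpos, by linarith, ?_⟩
  have h4 : ‖w‖⁻¹ • w - ν = ‖w‖⁻¹ • ((w - (δ / 2) • ν) - (‖w‖ - δ / 2) • ν) := by
    rw [show (w - (δ / 2) • ν) - (‖w‖ - δ / 2) • ν = w - ‖w‖ • ν by module, smul_sub, smul_smul,
      inv_mul_cancel₀ hpos.ne', one_smul]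
  have h5 : ‖(w - (δ / 2) • ν) - (‖w‖ - δ / 2) • ν‖ ≤ κ * δ / 4 := by
    refine (norm_sub_le _ _).trans ?_
    rw [norm_smul, hν, mul_one, Real.norm_eq_abs]
    linarith
  rw [h4, norm_smul, norm_inv, norm_norm, inv_mul_le_iff₀ hpos]
  have h0 : 0 ≤ κ := by
    have := (norm_nonneg _).trans hw
    by_contra! hneg
    nlinarith
  nlinarith

/-- Near the boundary, a stable solution dominates its value at `x` on a ball in `Ω` whose radius
does not depend on `x` or on the solution. -/
theorem exists_ball_le (hn : 0 < n) (hopen : IsOpen Ω) (hbdd : Bornology.IsBounded Ω)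
    (hconv : Convex ℝ Ω) (hp : 0 ≤ p) (hR : 0 < R) (hball : UniformInteriorBall Ω R) :
    ∃ ε > 0, ∃ r > 0, ∀ lam : ℝ, 0 < lam → ∀ u, IsStableSol Ω p lam u →
      ∀ x ∈ Ω, infDist x (frontier Ω) < ε → ∃ q, ball q r ⊆ Ω ∧ ∀ z ∈ ball q r, u x ≤ u z := by
  obtain ⟨M, hM⟩ := hbdd.closure.exists_norm_le
  have hD : (0 : ℝ) < 2 * |M| + 1 := by positivity
  set D := 2 * |M| + 1 with hDdef
  set δ := R / 2 with hδdef
  have hδ : 0 < δ := by positivity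
  set κ := min 1 (δ / (4 * D)) with hκdef
  have hκ : 0 < κ := by positivity
  have hκ1 : κ ≤ 1 := min_le_left _ _
  have hκD : D * κ ≤ δ / 4 := by
    have : κ ≤ δ / (4 * D) := min_le_right _ _
    rw [le_div_iff₀ (by positivity)] at this
    linarith
  refine ⟨δ / 4, by positivity, κ * δ / 8, by positivity, fun lam hlam u hu x hx hxε => ?_⟩
  have hfne : (frontier Ω).Nonempty := by
    have : Nonempty (Fin n) := ⟨⟨0, hn⟩⟩
    rw [nonempty_iff_ne_empty]
    intro h
    rcases frontier_eq_empty_iff.1 h with h' | h'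
    · rw [h'] at hx; exact hx
    · exact NormedSpace.unbounded_univ ℝ (EuclideanSpace ℝ (Fin n)) (h' ▸ hbdd)
  obtain ⟨y, hyf, hxy⟩ := (infDist_lt_iff hfne).1 hxε
  have hy : y ∈ closure Ω ∧ y ∉ Ω := by rwa [hopen.frontier_eq] at hyf
  obtain ⟨ν, hν, hsupp⟩ := exists_supporting_normal hopen hconv ⟨x, hx⟩ hy.2
  have key : ∀ q ∈ ball (x - (δ / 2) • ν) (κ * δ / 8), q ∈ Ω ∧ u x ≤ u q := by
    intro q hq
    rw [mem_ball, dist_comm, dist_eq_norm,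
      show x - (δ / 2) • ν - q = (x - q) - (δ / 2) • ν by abel] at hq
    obtain ⟨hs, hsδ, heν⟩ := norm_inv_smul_sub_le hδ hκ1 hν hq.le
    set s := ‖x - q‖
    set e := s⁻¹ • (x - q) with he
    have he1 : ‖e‖ = 1 := norm_smul_inv_norm (norm_pos_iff.1 hs)
    have hse : s • e = x - q := by rw [he, smul_smul, mul_inv_cancel₀ hs.ne', one_smul]
    have hm : ∀ z ∈ Ω, inner ℝ z e ≤ inner ℝ x e + δ / 2 := by
      intro z hz
      have h1 : inner ℝ (y - x) e ≤ δ / 4 := by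
        refine (real_inner_le_norm _ _).trans ?_
        rw [he1, mul_one, ← dist_eq_norm, dist_comm]
        exact hxy.le
      have h2 : inner ℝ (z - y) (e - ν) ≤ D * κ := by
        refine (real_inner_le_norm _ _).trans (mul_le_mul ?_ heν (norm_nonneg _) hD.le)
        refine (norm_sub_le _ _).trans ?_
        linarith [hM z (subset_closure hz), hM y hy.1, le_abs_self M]
      have h3 := hsupp z hz
      simp only [inner_sub_left, inner_sub_right] at h1 h2
      linarith
    have ht : inner ℝ x e - s / 2 ∈ Icc (inner ℝ x e + δ / 2 - δ) (inner ℝ x e + δ / 2) :=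
      ⟨by linarith, by linarith⟩
    have hlt : inner ℝ x e - s / 2 < inner ℝ x e := by linarith
    have hq' : planeRefl e (inner ℝ x e - s / 2) x = q := by
      rw [planeRefl, show 2 * (inner ℝ x e - s / 2 - inner ℝ x e) = -s by ring, neg_smul, hse]
      abel
    rw [← hq']
    exact ⟨planeRefl_mem he1 hm hR hball (by linarith [ht.1]) (subset_closure hx) hlt,
      hu.capMonotone hn hopen hbdd hconv hlam hp he1 hm hR hball (by linarith) ht x hx hlt⟩
  exact ⟨_, fun q hq => (key q hq).1, fun q hq => (key q hq).2⟩

theorem IsStableSol.integrableOn_rpow (hbdd : Bornology.IsBounded Ω)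
    (hu : IsStableSol Ω p lam u) (hopen : IsOpen Ω) :
    IntegrableOn (fun x => (1 + u x) ^ p) Ω := by
  have hcont : ContinuousOn (fun x => (1 + u x) ^ p) (closure Ω) := by
    refine ContinuousOn.rpow_const (continuous_const.add hu.1.continuous).continuousOn
      fun x hx => Or.inl ?_
    by_cases hxΩ : x ∈ Ω
    · linarith [hu.2.1 x hxΩ]
    · rw [(hu.2.2.2.1 x (by rw [hopen.frontier_eq]; exact ⟨hx, hxΩ⟩)).1]; norm_num
  exact (hcont.integrableOn_compact hbdd.isCompact_closure).mono_set subset_closure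

theorem IsStableSol.dim_pos (hlam : 0 < lam) (hu : IsStableSol Ω p lam u)
    {x : EuclideanSpace ℝ (Fin n)} (hx : x ∈ Ω) : 0 < n := by
  rcases n.eq_zero_or_pos with rfl | h
  · have h1 := hu.2.2.1 x hx
    have h2 : 0 < lam * (u x + 1) ^ p :=
      mul_pos hlam (Real.rpow_pos_of_pos (by linarith [hu.2.1 x hx]) p)
    rw [← h1] at h2
    simp [lap] at h2
  · exact h

end BoundaryBound

end

theorem stmt_14 (n : ℕ) (Ω : Set (EuclideanSpace ℝ (Fin n)))
    (hopen : IsOpen Ω) (hbdd : Bornology.IsBounded Ω) (hconv : Convex ℝ Ω)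
    (hsmooth : ∃ f : EuclideanSpace ℝ (Fin n) → ℝ, ContDiff ℝ (⊤ : ℕ∞) f ∧
      Ω = f ⁻¹' Set.Iio 0 ∧ frontier Ω = f ⁻¹' {0} ∧
      ∀ x ∈ frontier Ω, gradient f x ≠ 0)
    (p : ℝ) (hp : 1 < p)
    (C₁ : ℝ) (hC₁ : ∀ lam : ℝ, 0 < lam → ∀ u, IsStableSol Ω p lam u →
      ∫ x in Ω, (1 + u x) ^ p ≤ C₁) :
    ∃ C > 0, ∃ ε > 0, ∀ lam : ℝ, 0 < lam → ∀ u, IsStableSol Ω p lam u →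
      ∀ x ∈ Ω, Metric.infDist x (frontier Ω) < ε → u x < C := by
  rcases n.eq_zero_or_pos with rfl | hn
  · exact ⟨1, one_pos, 1, one_pos, fun lam hlam u hu x hx _ =>
      absurd (hu.dim_pos hlam hx) (lt_irrefl 0)⟩
  obtain ⟨f, hf, hΩ, hfr, hgrad⟩ := hsmooth
  obtain ⟨R, hR, hRball⟩ := exists_interior_ball_of_defining_function hbdd
    (contDiff_infty.1 hf 2) hΩ
    (fun x hx => by rw [hfr] at hx; exact hx) hgrad
  obtain ⟨ε, hε, r, hr, h⟩ := exists_ball_le (p := p) hn hopen hbdd hconv (by linarith) hR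
    (uniformInteriorBall_of_frontier hopen hconv hR hRball)
  have hv : 0 < volume.real (Metric.ball (0 : EuclideanSpace ℝ (Fin n)) r) :=
    ENNReal.toReal_pos (Metric.measure_ball_pos volume 0 hr).ne' Metric.isBounded_ball.measure_lt_top.ne
  set V := volume.real (Metric.ball (0 : EuclideanSpace ℝ (Fin n)) r)
  refine ⟨|C₁| / V + 1, by positivity, ε, hε, fun lam hlam u hu x hx hxε => ?_⟩
  obtain ⟨q, hq, hle⟩ := h lam hlam u hu x hx hxε
  have hux : 0 < u x := hu.2.1 x hx
  have hint := hu.integrableOn_rpow hbdd hopen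
  have h1 : (1 + u x) ^ p * V ≤ ∫ z in Metric.ball q r, (1 + u z) ^ p := by
    have := setIntegral_ge_of_const_le_real (μ := volume) (c := (1 + u x) ^ p)
      Metric.isOpen_ball.measurableSet Metric.isBounded_ball.measure_lt_top.ne
      (fun z hz => Real.rpow_le_rpow (by linarith) (by linarith [hle z hz]) (by linarith))
      (hint.mono_set hq)
    rwa [Measure.addHaar_real_ball_center] at this
  have h2 : ∫ z in Metric.ball q r, (1 + u z) ^ p ≤ ∫ z in Ω, (1 + u z) ^ p := by
    refine setIntegral_mono_set hint ?_ hq.eventuallyLE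
    filter_upwards [ae_restrict_mem hopen.measurableSet] with z hz
    exact Real.rpow_nonneg (by linarith [hu.2.1 z hz]) p
  have h3 : (1 + u x) * V ≤ |C₁| := by
    have h4 : 1 + u x ≤ (1 + u x) ^ p := Real.self_le_rpow_of_one_le (by linarith) hp.le
    have := mul_le_mul_of_nonneg_right h4 hv.le
    linarith [hC₁ lam hlam u hu, le_abs_self C₁]
  rw [← le_div_iff₀ hv] at h3
  linarith
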